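/- Let a < b be real numbers and let ℓ ≥ 3 be a natural number. For every v_a, v_b, d_a, d_b ∈ ℝ and every function g : ℕ → ℝ, there exists a unique real polynomial p of degree at most ℓ such that p(a) = v_a, p(b) = v_b, p′(a) = d_a, p′(b) = d_b, and ∫_a^b p(x) x^j dx = g(j) for every natural number j with j < ℓ − 3 (no integral conditions when ℓ = 3). -/

import Mathlib

open Polynomial intervalIntegral

/-- The linear functional sending a polynomial to its `j`-th monomial moment on `[a, b]`. -/
noncomputable def intervalMoment (a b : ℝ) (j : ℕ) : ℝ[X] →ₗ[ℝ] ℝ where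
  toFun p := ∫ x in a..b, p.eval x * x ^ j
  map_add' p q := by
    simp only [eval_add, add_mul]
    exact integral_add ((p.continuous.mul (continuous_pow j)).intervalIntegrable a b)
      ((q.continuous.mul (continuous_pow j)).intervalIntegrable a b)
  map_smul' c p := by
    simp [mul_assoc]

/-- Endpoint values, endpoint derivative values and the first `n` moments of a polynomial. -/
noncomputable def hermiteMoments (a b : ℝ) (n : ℕ) :
    ℝ[X] →ₗ[ℝ] ℝ × ℝ × ℝ × ℝ × (Fin n → ℝ) :=
  (leval a).prod <| (leval b).prod <| (leval a ∘ₗ derivative).prod <|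
    (leval b ∘ₗ derivative).prod <| LinearMap.pi fun j => intervalMoment a b j

theorem hermiteMoments_eq_iff {a b : ℝ} {n : ℕ} {p : ℝ[X]} {va vb da db : ℝ} {g : ℕ → ℝ} :
    hermiteMoments a b n p = (va, vb, da, db, fun j : Fin n => g j) ↔
      p.eval a = va ∧ p.eval b = vb ∧ p.derivative.eval a = da ∧ p.derivative.eval b = db ∧
        ∀ j : ℕ, j < n → (∫ x in a..b, p.eval x * x ^ j) = g j := by
  simp [hermiteMoments, intervalMoment, LinearMap.prod_apply, funext_iff, Fin.forall_iff,
    leval_apply]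

theorem sq_X_sub_C_dvd_of_eval_eq_zero {R : Type*} [CommRing R] {p : R[X]} {a : R}
    (h : p.eval a = 0) (h' : p.derivative.eval a = 0) : (X - C a) ^ 2 ∣ p := by
  rcases eq_or_ne p 0 with rfl | hp
  · exact dvd_zero _
  · exact (le_rootMultiplicity_iff hp).1 ((one_lt_rootMultiplicity_iff_isRoot hp).2 ⟨h, h'⟩)

theorem integral_eval_mul_eval_eq_zero {a b : ℝ} {n : ℕ} {p q : ℝ[X]} (hq : q.natDegree < n)
    (h : ∀ j < n, (∫ x in a..b, p.eval x * x ^ j) = 0) :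
    (∫ x in a..b, p.eval x * q.eval x) = 0 := by
  have key : ∀ x, p.eval x * q.eval x =
      ∑ j ∈ Finset.range n, q.coeff j * (p.eval x * x ^ j) := fun x => by
    rw [eval_eq_sum_range' hq, Finset.mul_sum]
    exact Finset.sum_congr rfl fun j _ => by ring
  simp_rw [key]
  rw [integral_finsetSum]
  · refine Finset.sum_eq_zero fun j hj => ?_
    rw [integral_const_mul, h j (Finset.mem_range.1 hj), mul_zero]
  · exact fun j _ =>
      ((p.continuous.mul (continuous_pow j)).intervalIntegrable a b).const_mul (q.coeff j)

theorem eq_zero_of_integral_eval_sq_eq_zero {a b : ℝ} (hab : a < b) {r : ℝ[X]}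
    (h : (∫ x in a..b, r.eval x ^ 2) = 0) : r = 0 := by
  refine eq_zero_of_infinite_isRoot r ((Set.Icc_infinite hab).mono fun x hx => ?_)
  by_contra hr
  exact (integral_pos hab (r.continuous.pow 2).continuousOn (fun y _ => sq_nonneg _)
    ⟨x, hx, (sq_nonneg _).lt_of_ne' (pow_ne_zero 2 hr)⟩).ne' h

theorem eq_zero_of_hermiteMoments_eq_zero {a b : ℝ} (hab : a < b) {n : ℕ} {p : ℝ[X]}
    (hp : p.natDegree < n + 4) (h : hermiteMoments a b n p = 0) : p = 0 := by
  obtain ⟨ha, hb, ha', hb', hm⟩ := (hermiteMoments_eq_iff (g := fun _ => 0)).1 h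
  have hcop : IsCoprime ((X - C a) ^ 2) ((X - C b) ^ 2) :=
    (isCoprime_X_sub_C_of_isUnit_sub (sub_ne_zero.2 hab.ne).isUnit).pow
  obtain ⟨q, rfl⟩ := hcop.mul_dvd (sq_X_sub_C_dvd_of_eval_eq_zero ha ha')
    (sq_X_sub_C_dvd_of_eval_eq_zero hb hb')
  rcases eq_or_ne q 0 with rfl | hq
  · exact mul_zero _
  have hmonic : ((X - C a) ^ 2 * (X - C b) ^ 2).Monic :=
    ((monic_X_sub_C a).pow 2).mul ((monic_X_sub_C b).pow 2)
  have hdeg : ((X - C a) ^ 2 * (X - C b) ^ 2).natDegree = 4 := by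
    rw [((monic_X_sub_C a).pow 2).natDegree_mul ((monic_X_sub_C b).pow 2)]
    simp
  have hqdeg : q.natDegree < n := by
    rw [hmonic.natDegree_mul' hq, hdeg] at hp
    omega
  have hint := integral_eval_mul_eval_eq_zero hqdeg hm
  have hr : (X - C a) * (X - C b) * q = 0 := by
    refine eq_zero_of_integral_eval_sq_eq_zero hab (hint ▸ ?_)
    congr 1 with x
    simp only [eval_mul, eval_pow]
    ring
  exact absurd hr (mul_ne_zero (mul_ne_zero (X_sub_C_ne_zero a) (X_sub_C_ne_zero b)) hq)

theorem hermiteMoments_bijective {a b : ℝ} (hab : a < b) (n : ℕ) :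
    Function.Bijective ((hermiteMoments a b n).domRestrict (degreeLT ℝ (n + 4))) := by
  have : FiniteDimensional ℝ (degreeLT ℝ (n + 4)) :=
    Module.Finite.equiv (degreeLTEquiv ℝ (n + 4)).symm
  have hinj : Function.Injective
      ((hermiteMoments a b n).domRestrict (degreeLT ℝ (n + 4))) := by
    refine (injective_iff_map_eq_zero _).2 fun p hp => Subtype.ext ?_
    rcases eq_or_ne (p : ℝ[X]) 0 with h0 | h0
    · exact h0
    · exact eq_zero_of_hermiteMoments_eq_zero hab
        ((natDegree_lt_iff_degree_lt h0).2 (mem_degreeLT.1 p.2)) hp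
  refine ⟨hinj, (LinearMap.injective_iff_surjective_of_finrank_eq_finrank ?_).1 hinj⟩
  rw [(degreeLTEquiv ℝ (n + 4)).finrank_eq]
  simp
  omega

theorem h2_conforming_edge_value_projection_wellposed
    (a b : ℝ) (hab : a < b) (ℓ : ℕ) (hℓ : 3 ≤ ℓ)
    (va vb da db : ℝ) (g : ℕ → ℝ) :
    ∃! p : Polynomial ℝ, p.natDegree ≤ ℓ ∧ p.eval a = va ∧ p.eval b = vb ∧
      p.derivative.eval a = da ∧ p.derivative.eval b = db ∧
      ∀ j : ℕ, j < ℓ - 3 → (∫ x in a..b, p.eval x * x ^ j) = g j := by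
  have hmem : ∀ p : ℝ[X], p ∈ degreeLT ℝ (ℓ - 3 + 4) ↔ p.natDegree ≤ ℓ := fun p => by
    rw [show ℓ - 3 + 4 = ℓ + 1 by omega, degreeLT_succ_eq_degreeLE, mem_degreeLE,
      natDegree_le_iff_degree_le]
  obtain ⟨p, hp, huniq⟩ := (hermiteMoments_bijective hab (ℓ - 3)).existsUnique
    (va, vb, da, db, fun j : Fin (ℓ - 3) => g j)
  refine ⟨p, ⟨(hmem p).1 p.2, hermiteMoments_eq_iff.1 hp⟩, fun q hq => ?_⟩
  exact congrArg Subtype.val (huniq ⟨q, (hmem q).2 hq.1⟩ (hermiteMoments_eq_iff.2 hq.2))
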